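/- Let α be an expansive partition of exponent θ ≥ 0 that is eventually decreasing. Then dim_H(F_∞^(α)) ≥ 1/(1+θ), where F_∞^(α) = {x = [ℓ_1(x), ℓ_2(x), ...]_α : ℓ_n(x) → ∞ and ℓ_n(x) ≥ ℓ_{n-1}(x) for all n}. -/

import Mathlib

open Filter Set MeasureTheory Topology

noncomputable section

/-- Data of a countable interval partition `α` of `(0,1]`: `a n` is the Lebesgue
measure of the `n`-th atom `A_n` (for `n ≥ 1`), the atoms are ordered from right
to left and their measures sum to `1`. -/
structure LurothData where
  a : ℕ → ℝ
  pos : ∀ n, 1 ≤ n → 0 < a n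
  summ : Summable fun n => a (n + 1)
  total : (∑' n : ℕ, a (n + 1)) = 1

namespace LurothData

variable (P : LurothData)

/-- the `n`-th tail `t_n = Σ_{k ≥ n} a_k`. -/
def t (n : ℕ) : ℝ := ∑' k : ℕ, P.a (n + k)

/-- the index `n` of the atom `A_n = (t_{n+1}, t_n]` containing `x` (and `0` if none). -/
def digit (x : ℝ) : ℕ := sInf {n | 1 ≤ n ∧ x ∈ Set.Ioc (P.t (n + 1)) (P.t n)}

/-- the α-Lüroth map `L_α`. -/
def map (x : ℝ) : ℝ :=
  if P.digit x = 0 then 0 else (P.t (P.digit x) - x) / P.a (P.digit x)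

/-- `dseq P n x` is the `(n+1)`-st α-Lüroth digit `ℓ_{n+1}(x)`. -/
def dseq (n : ℕ) (x : ℝ) : ℕ := P.digit (P.map^[n] x)

/-- the finite α-Lüroth expansion `[ℓ_1, …, ℓ_k]_α`. -/
def val : List ℕ → ℝ
  | [] => 0
  | l :: ls => P.t l - P.a l * val ls

/-- the α-Lüroth cylinder set `C_α(ℓ_1, …, ℓ_k)` (as the set of points whose
first `k` digits are prescribed). -/
def cyl (ls : List ℕ) : Set ℝ :=
  {x | x ∈ Set.Ioc (0 : ℝ) 1 ∧ ∀ i : Fin ls.length, P.dseq i x = ls.get i}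

end LurothData

/-- A (discretely sampled) slowly varying function. -/
def SlowlyVaryingN (ψ : ℕ → ℝ) : Prop :=
  ∀ c : ℕ, 0 < c → Tendsto (fun n => ψ (c * n) / ψ n) atTop (𝓝 1)

/-- `α` is expansive of exponent `θ`: `t_n = ψ(n) n^{-θ}` with `ψ` slowly varying. -/
def LurothData.Expansive (P : LurothData) (θ : ℝ) : Prop :=
  ∃ ψ : ℕ → ℝ, (∀ n, 0 < ψ n) ∧ SlowlyVaryingN ψ ∧
    ∀ n, 1 ≤ n → P.t n = ψ n * (n : ℝ) ^ (-θ)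

/-- `α` is eventually decreasing. -/
def LurothData.EventuallyDecreasing (P : LurothData) : Prop :=
  ∃ N : ℕ, ∀ n, N ≤ n → P.a (n + 1) < P.a n

/-- the α-Good set `G_N^{(α)}`. -/
def LurothData.goodSet (P : LurothData) (N : ℕ) : Set ℝ :=
  {x | x ∈ Set.Ioc (0 : ℝ) 1 ∧ ∀ n : ℕ, N < P.dseq n x}

/-- `G_∞^{(α)}`: points whose digits tend to infinity. -/
def LurothData.Ginf (P : LurothData) : Set ℝ :=
  {x | x ∈ Set.Ioc (0 : ℝ) 1 ∧ Tendsto (fun n => P.dseq n x) atTop atTop}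

/-- `F_∞^{(α)}`: points whose digits are non-decreasing and tend to infinity. -/
def LurothData.Finf (P : LurothData) : Set ℝ :=
  {x | x ∈ P.Ginf ∧ ∀ n : ℕ, P.dseq n x ≤ P.dseq (n + 1) x}

end

/-- If `g` maps `[0,1)` into `F` and has a Hölder continuous inverse of exponent `s`, then `F` has
Hausdorff dimension at least `s`. -/
lemma le_dimH_of_abs_sub_le_rpow {F : Set ℝ} {g : ℝ → ℝ} {C s : ℝ} (hs : 0 < s)
    (hC : 0 ≤ C) (hg : ∀ y ∈ Ico (0 : ℝ) 1, g y ∈ F)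
    (hgC : ∀ y ∈ Ico (0 : ℝ) 1, ∀ z ∈ Ico (0 : ℝ) 1, |y - z| ≤ C * |g y - g z| ^ s) :
    ENNReal.ofReal s ≤ dimH F := by
  have hinj : InjOn g (Ico 0 1) := fun y hy z hz hyz => by
    have h := hgC y hy z hz
    rw [hyz, sub_self, abs_zero, Real.zero_rpow hs.ne', mul_zero] at h
    exact sub_eq_zero.mp (abs_nonpos_iff.mp h)
  have hinv := hinj.leftInvOn_invFunOn
  have hH : HolderOnWith C.toNNReal s.toNNReal (Function.invFunOn g (Ico 0 1))
      (g '' Ico 0 1) := by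
    rintro _ ⟨y, hy, rfl⟩ _ ⟨z, hz, rfl⟩
    rw [hinv hy, hinv hz, edist_dist, edist_dist, Real.dist_eq, Real.dist_eq,
      Real.coe_toNNReal s hs.le, ENNReal.ofReal_rpow_of_nonneg (abs_nonneg _) hs.le]
    change _ ≤ ENNReal.ofReal C * _
    rw [← ENNReal.ofReal_mul hC]
    exact ENNReal.ofReal_le_ofReal (hgC y hy z hz)
  have h1 := hH.dimH_image_le (Real.toNNReal_pos.mpr hs)
  rw [hinv.image_image, Real.dimH_of_nonempty_interior (by simp)] at h1
  have hs0 : (s.toNNReal : ENNReal) ≠ 0 := by simpa using hs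
  rw [ENNReal.le_div_iff_mul_le (Or.inl hs0) (Or.inl ENNReal.coe_ne_top)] at h1
  calc ENNReal.ofReal s ≤ dimH (g '' Ico 0 1) := by simpa [ENNReal.ofReal] using h1
    _ ≤ dimH F := dimH_mono (image_subset_iff.mpr hg)

namespace LurothData

variable (P : LurothData)

lemma summable_tail {n : ℕ} (hn : 1 ≤ n) : Summable fun k => P.a (n + k) := by
  have h := (summable_nat_add_iff (n - 1)).mpr P.summ
  refine h.congr fun k => ?_
  congr 1
  omega

lemma t_eq_add {n : ℕ} (hn : 1 ≤ n) : P.t n = P.a n + P.t (n + 1) := by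
  unfold t
  rw [(P.summable_tail hn).tsum_eq_zero_add]
  simp [add_comm, add_left_comm]

lemma t_one : P.t 1 = 1 := by
  rw [← P.total]
  unfold t
  simp [add_comm]

lemma t_pos {n : ℕ} (hn : 1 ≤ n) : 0 < P.t n :=
  (P.summable_tail hn).tsum_pos (fun k => (P.pos _ (by omega)).le) 0 (P.pos _ (by omega))

lemma t_lt {m n : ℕ} (hm : 1 ≤ m) (hmn : m < n) : P.t n < P.t m := by
  induction n, hmn using Nat.le_induction with
  | base => linarith [P.t_eq_add hm, P.pos m hm]
  | succ n hn ih =>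
    have hn1 : 1 ≤ n := by grind
    linarith [P.t_eq_add hn1, P.pos n hn1]

lemma t_le {m n : ℕ} (hm : 1 ≤ m) (hmn : m ≤ n) : P.t n ≤ P.t m := by
  rcases hmn.eq_or_lt with rfl | h
  · rfl
  · exact (P.t_lt hm h).le

lemma a_le_t_sub {m n : ℕ} (hm : 1 ≤ m) (hmn : m < n) : P.a m ≤ P.t m - P.t n := by
  have := P.t_le (show 1 ≤ m + 1 by omega) (Nat.succ_le_of_lt hmn)
  linarith [P.t_eq_add hm]

lemma tendsto_t : Tendsto P.t atTop (𝓝 0) := by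
  have h := tendsto_sum_nat_add fun n => P.a (n + 1)
  rw [← tendsto_add_atTop_iff_nat 1]
  refine h.congr fun n => ?_
  unfold t
  exact tsum_congr fun k => by congr 1; omega

lemma digit_eq {x : ℝ} {n : ℕ} (hn : 1 ≤ n) (hx : x ∈ Ioc (P.t (n + 1)) (P.t n)) :
    P.digit x = n := by
  have : {m | 1 ≤ m ∧ x ∈ Ioc (P.t (m + 1)) (P.t m)} = {n} := by
    ext m
    simp only [mem_ofPred_eq, mem_singleton_iff]
    refine ⟨fun ⟨hm, hxm⟩ => ?_, fun h => h ▸ ⟨hn, hx⟩⟩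
    by_contra hne
    rcases Nat.lt_or_gt_of_ne hne with h | h
    · linarith [P.t_le (show 1 ≤ m + 1 by omega) (Nat.succ_le_of_lt h), hx.2, hxm.1]
    · linarith [P.t_le (show 1 ≤ n + 1 by omega) (Nat.succ_le_of_lt h), hx.1, hxm.2]
  rw [digit, this, csInf_singleton]

lemma map_eq {x : ℝ} {n : ℕ} (hn : 1 ≤ n) (hx : x ∈ Ioc (P.t (n + 1)) (P.t n)) :
    P.map x = (P.t n - x) / P.a n := by
  rw [map, P.digit_eq hn hx, if_neg (by omega)]

/-- A sequence of points of `[0,1)` following the inverse branches with indices `n` realises `n`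
as digit sequence. -/
lemma dseq_eq {n : ℕ → ℕ} {x : ℕ → ℝ} (hn : ∀ k, 1 ≤ n k) (hx : ∀ k, x k ∈ Ico (0 : ℝ) 1)
    (hrec : ∀ k, x k = P.t (n k) - P.a (n k) * x (k + 1)) (k : ℕ) :
    P.dseq k (x 0) = n k := by
  have hmem : ∀ k, x k ∈ Ioc (P.t (n k + 1)) (P.t (n k)) := fun k => by
    have h1 := hx (k + 1)
    have h2 := P.pos _ (hn k)
    have h3 := P.t_eq_add (hn k)
    have h4 := hrec k
    constructor <;> nlinarith [h1.1, h1.2]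
  have hit : ∀ k, P.map^[k] (x 0) = x k := fun k => by
    induction k with
    | zero => rfl
    | succ k ih =>
      rw [Function.iterate_succ_apply', ih, P.map_eq (hn k) (hmem k), hrec k]
      field_simp [(P.pos _ (hn k)).ne']
      ring
  rw [dseq, hit, P.digit_eq (hn k) (hmem k)]

/-- Alternating series for the point with a prescribed sequence of large digits. -/
lemma exists_point {n : ℕ → ℕ} (hn : ∀ k, 1 ≤ n k) (ht : ∀ k, P.t (n k) ≤ 1 / 4) :
    ∃ x : ℕ → ℝ, (∀ k, 0 < x k ∧ x k ≤ 1 / 2) ∧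
      ∀ k, x k = P.t (n k) - P.a (n k) * x (k + 1) := by
  have ha : ∀ k, P.a (n k) ≤ P.t (n k) := fun k => by
    linarith [P.t_eq_add (hn k), P.t_pos (show 1 ≤ n k + 1 by omega)]
  let F : ℕ → ℕ → ℝ := fun k j => (∏ i ∈ Finset.range j, -P.a (n (k + i))) * P.t (n (k + j))
  have hF : ∀ k j, ‖F k j‖ ≤ 1 / 4 * (1 / 2) ^ j := fun k j => by
    simp only [F, norm_mul, norm_prod, norm_neg]
    rw [mul_comm]
    refine mul_le_mul ?_ ?_ (Finset.prod_nonneg fun _ _ => norm_nonneg _) (by norm_num)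
    · rw [Real.norm_of_nonneg (P.t_pos (hn _)).le]
      exact ht _
    · calc ∏ i ∈ Finset.range j, ‖P.a (n (k + i))‖ ≤ ∏ _i ∈ Finset.range j, (1 / 2 : ℝ) := by
            refine Finset.prod_le_prod (fun _ _ => norm_nonneg _) fun i _ => ?_
            rw [Real.norm_of_nonneg (P.pos _ (hn _)).le]
            linarith [ha (k + i), ht (k + i)]
        _ = (1 / 2) ^ j := by simp
  have hsum : HasSum (fun j : ℕ => (1 / 4 : ℝ) * (1 / 2) ^ j) (1 / 2) := by
    have h := hasSum_geometric_two.mul_left (1 / 4 : ℝ)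
    rwa [show (1 / 4 : ℝ) * 2 = 1 / 2 by norm_num] at h
  have hFs : ∀ k, Summable (F k) := fun k => hsum.summable.of_norm_bounded (hF k)
  have hbd : ∀ k, ‖∑' j, F k j‖ ≤ 1 / 2 := fun k => tsum_of_norm_bounded hsum (hF k)
  have hrec : ∀ k, ∑' j, F k j = P.t (n k) - P.a (n k) * ∑' j, F (k + 1) j := fun k => by
    rw [(hFs k).tsum_eq_zero_add, ← tsum_mul_left, sub_eq_add_neg, ← tsum_neg]
    congr 1
    · simp [F]
    · refine tsum_congr fun j => ?_
      simp only [F, Finset.prod_range_succ', add_zero]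
      have hi : ∀ i, k + (i + 1) = k + 1 + i := fun i => by omega
      rw [hi, Finset.prod_congr rfl fun i _ => by rw [hi i]]
      ring
  refine ⟨fun k => ∑' j, F k j, fun k => ⟨?_, (le_abs_self _).trans (hbd k)⟩, hrec⟩
  have h1 := (le_abs_self _).trans (hbd (k + 1))
  have h2 := P.pos _ (hn k)
  change 0 < ∑' j, F k j
  rw [hrec k]
  nlinarith [ha k]

lemma exists_doubling {θ η : ℝ} (hexp : P.Expansive θ) (hη : θ < η) :
    ∃ M, 2 ≤ M ∧ ∀ n, M ≤ n → (2 : ℝ) ^ (-η) * P.t n ≤ P.t (2 * n) := by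
  obtain ⟨ψ, hψ, hslow, ht⟩ := hexp
  have hlim : Tendsto (fun n => ψ (2 * n) / ψ n * (2 : ℝ) ^ (-θ)) atTop (𝓝 ((2 : ℝ) ^ (-θ))) := by
    simpa using (hslow 2 two_pos).mul_const ((2 : ℝ) ^ (-θ))
  have hlt : (2 : ℝ) ^ (-η) < (2 : ℝ) ^ (-θ) :=
    Real.rpow_lt_rpow_of_exponent_lt one_lt_two (by linarith)
  obtain ⟨M, hM⟩ := eventually_atTop.mp (hlim.eventually (lt_mem_nhds hlt))
  refine ⟨max M 2, le_max_right _ _, fun n hn => ?_⟩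
  have hn2 : 2 ≤ n := (le_max_right _ _).trans hn
  have h := hM n ((le_max_left _ _).trans hn)
  have hψn := hψ n
  rw [ht n (by omega), ht (2 * n) (by omega)]
  have hpow : ((2 * n : ℕ) : ℝ) ^ (-θ) = (2 : ℝ) ^ (-θ) * (n : ℝ) ^ (-θ) := by
    push_cast
    exact Real.mul_rpow two_pos.le n.cast_nonneg
  have hnθ : (0 : ℝ) ≤ (n : ℝ) ^ (-θ) := by positivity
  calc (2 : ℝ) ^ (-η) * (ψ n * (n : ℝ) ^ (-θ))
      ≤ ψ (2 * n) / ψ n * (2 : ℝ) ^ (-θ) * (ψ n * (n : ℝ) ^ (-θ)) := by gcongr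
    _ = ψ (2 * n) * ((2 * n : ℕ) : ℝ) ^ (-θ) := by
      rw [hpow]
      field_simp

lemma exists_le_t {η : ℝ} (hη : 0 ≤ η) {M : ℕ} (hM : 2 ≤ M)
    (hd : ∀ n, M ≤ n → (2 : ℝ) ^ (-η) * P.t n ≤ P.t (2 * n)) :
    ∃ c, 0 < c ∧ ∀ n, M ≤ n → c * (n : ℝ) ^ (-η) ≤ P.t n := by
  have hc : 0 < P.t (2 * M) := P.t_pos (by omega)
  have key : ∀ n, M ≤ n → P.t (2 * M) * ((n : ℝ) - 1) ^ (-η) ≤ P.t n := by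
    intro n
    induction n using Nat.strong_induction_on with
    | _ n ih =>
      intro hn
      have hn2 : (2 : ℝ) ≤ n := by exact_mod_cast hM.trans hn
      rcases lt_or_ge n (2 * M) with h | h
      · calc P.t (2 * M) * ((n : ℝ) - 1) ^ (-η) ≤ P.t (2 * M) * 1 := by
              gcongr
              exact Real.rpow_le_one_of_one_le_of_nonpos (by linarith) (by linarith)
          _ ≤ P.t n := by
              rw [mul_one]
              exact P.t_le (by omega) h.le
      · obtain ⟨m, hm1, hm2⟩ : ∃ m, n ≤ 2 * m ∧ 2 * m ≤ n + 1 := ⟨(n + 1) / 2, by omega, by omega⟩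
        have hmM : M ≤ m := by omega
        have hmr : (2 : ℝ) ≤ m := by exact_mod_cast hM.trans hmM
        have hm2r : (2 : ℝ) * m ≤ n + 1 := by exact_mod_cast hm2
        calc P.t (2 * M) * ((n : ℝ) - 1) ^ (-η)
            ≤ P.t (2 * M) * (2 * ((m : ℝ) - 1)) ^ (-η) := by
              gcongr ?_ * ?_
              exact Real.rpow_le_rpow_of_nonpos (by linarith) (by linarith) (by linarith)
          _ = (2 : ℝ) ^ (-η) * (P.t (2 * M) * ((m : ℝ) - 1) ^ (-η)) := by
              rw [Real.mul_rpow two_pos.le (by linarith)]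
              ring
          _ ≤ (2 : ℝ) ^ (-η) * P.t m := by
              gcongr
              exact ih m (by omega) hmM
          _ ≤ P.t (2 * m) := hd m hmM
          _ ≤ P.t n := P.t_le (by omega) hm1
  refine ⟨P.t (2 * M), hc, fun n hn => le_trans ?_ (key n hn)⟩
  have hn2 : (2 : ℝ) ≤ n := by exact_mod_cast hM.trans hn
  gcongr ?_ * ?_
  exact Real.rpow_le_rpow_of_nonpos (by linarith) (by linarith) (by linarith)

lemma mul_a_le {m n : ℕ} (hm : 1 ≤ m) (hmn : m ≤ n)
    (hdec : ∀ k, m ≤ k → P.a (k + 1) ≤ P.a k) :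
    ((n : ℝ) - m) * P.a n ≤ P.t m - P.t n := by
  induction n, hmn using Nat.le_induction with
  | base => simp
  | succ n hn ih =>
    have h1 := P.t_eq_add (hm.trans hn)
    have h2 := hdec n hn
    have h3 : (m : ℝ) ≤ n := by exact_mod_cast hn
    push_cast
    nlinarith

lemma exists_a_le {η : ℝ} {M : ℕ} (hM : 2 ≤ M)
    (hd : ∀ n, M ≤ n → (2 : ℝ) ^ (-η) * P.t n ≤ P.t (2 * n))
    (hdec : ∀ n, M ≤ n → P.a (n + 1) ≤ P.a n) :
    ∃ K, 0 < K ∧ ∀ n, 2 * M ≤ n → P.a n ≤ K * P.t n / n := by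
  have hpos : (0 : ℝ) < (2 : ℝ) ^ (-η) := by positivity
  refine ⟨4 / (2 : ℝ) ^ (-η), by positivity, fun n hn => ?_⟩
  obtain ⟨m, hm1, hm2⟩ : ∃ m, n ≤ 2 * m ∧ 2 * m ≤ n + 2 := ⟨n / 2 + 1, by omega, by omega⟩
  have hmM : M ≤ m := by omega
  have h1 := P.mul_a_le (show 1 ≤ m by omega) (show m ≤ n by omega)
    fun k hk => hdec k (hmM.trans hk)
  have h2 := (hd m hmM).trans (P.t_le (by omega) hm1)
  have hn4 : (4 : ℝ) ≤ n := by exact_mod_cast (by omega : 4 ≤ n)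
  have hm2r : (2 : ℝ) * m ≤ n + 2 := by exact_mod_cast hm2
  have htn := P.t_pos (show 1 ≤ n by omega)
  have han := P.pos n (by omega)
  have h3 : P.t m ≤ P.t n / (2 : ℝ) ^ (-η) := by
    rw [le_div_iff₀ hpos]
    linarith
  rw [le_div_iff₀ (by linarith)]
  calc P.a n * n ≤ 4 * P.t m := by nlinarith
    _ ≤ 4 * (P.t n / (2 : ℝ) ^ (-η)) := by linarith
    _ = 4 / (2 : ℝ) ^ (-η) * P.t n := by ring

lemma eventually_a_le_mul_t {K : ℝ} {M : ℕ} (hM : 1 ≤ M)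
    (hK : ∀ n, M ≤ n → P.a n ≤ K * P.t n / n) {ε : ℝ} (hε : 0 < ε) :
    ∀ᶠ n in atTop, P.a n ≤ ε * P.t n := by
  have h := (tendsto_const_nhds (x := K)).div_atTop (tendsto_natCast_atTop_atTop (R := ℝ))
  filter_upwards [h.eventually (gt_mem_nhds hε), eventually_ge_atTop M] with n hn hnM
  have := P.t_pos (hM.trans hnM)
  calc P.a n ≤ K * P.t n / n := hK n hnM
    _ = K / n * P.t n := by ring
    _ ≤ ε * P.t n := by gcongr

lemma eventually_rpow_a_le_mul_t {K c η s : ℝ} {M : ℕ} (hM : 1 ≤ M) (hc : 0 < c) (hK0 : 0 < K)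
    (hK : ∀ n, M ≤ n → P.a n ≤ K * P.t n / n)
    (ht : ∀ n, M ≤ n → c * (n : ℝ) ^ (-η) ≤ P.t n) (hs : 0 < s) (hs1 : s < 1)
    (hsη : s * (1 + η) < 1) {ε : ℝ} (hε : 0 < ε) :
    ∀ᶠ n in atTop, P.a n ^ (1 - s) ≤ ε * P.t n := by
  have h : Tendsto (fun n : ℕ => K ^ (1 - s) * c ^ (-s) * (n : ℝ) ^ (-(1 - s * (1 + η))))
      atTop (𝓝 0) := by
    simpa using ((tendsto_rpow_neg_atTop (show 0 < 1 - s * (1 + η) by linarith)).comp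
      (tendsto_natCast_atTop_atTop (R := ℝ))).const_mul (K ^ (1 - s) * c ^ (-s))
  filter_upwards [h.eventually (gt_mem_nhds hε), eventually_ge_atTop M] with n hn hnM
  have hn1 : 1 ≤ n := hM.trans hnM
  have hn0 : (0 : ℝ) < n := by exact_mod_cast hn1
  have htn := P.t_pos hn1
  have h1 : P.t n ^ (-s) ≤ c ^ (-s) * (n : ℝ) ^ (η * s) := by
    calc P.t n ^ (-s) ≤ (c * (n : ℝ) ^ (-η)) ^ (-s) :=
          Real.rpow_le_rpow_of_nonpos (by positivity) (ht n hnM) (by linarith)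
      _ = c ^ (-s) * (n : ℝ) ^ (η * s) := by
          rw [Real.mul_rpow hc.le (by positivity), ← Real.rpow_mul hn0.le]
          ring_nf
  calc P.a n ^ (1 - s) ≤ (K * P.t n / n) ^ (1 - s) :=
        Real.rpow_le_rpow (P.pos n hn1).le (hK n hnM) (by linarith)
    _ = K ^ (1 - s) * P.t n ^ (-s) * (n : ℝ) ^ (-(1 - s)) * P.t n := by
        rw [Real.div_rpow (by positivity) hn0.le, Real.mul_rpow hK0.le htn.le, Real.rpow_neg hn0.le,
          show 1 - s = -s + 1 by ring, Real.rpow_add htn, Real.rpow_one]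
        ring
    _ ≤ K ^ (1 - s) * (c ^ (-s) * (n : ℝ) ^ (η * s)) * (n : ℝ) ^ (-(1 - s)) * P.t n := by gcongr
    _ = K ^ (1 - s) * c ^ (-s) * (n : ℝ) ^ (-(1 - s * (1 + η))) * P.t n := by
        rw [show -(1 - s * (1 + η)) = η * s + -(1 - s) by ring, Real.rpow_add hn0]
        ring
    _ ≤ ε * P.t n := by gcongr

lemma exists_index {M N : ℕ} {z : ℝ} (hNM : N < M) (hz : z ∈ Ioc (P.t M) (P.t N)) :
    ∃ n, N ≤ n ∧ n < M ∧ z ∈ Ioc (P.t (n + 1)) (P.t n) := by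
  classical
  have hex : ∃ n, N ≤ n ∧ P.t (n + 1) < z :=
    ⟨M - 1, by omega, by rw [Nat.sub_add_cancel (by omega)]; exact hz.1⟩
  obtain ⟨h1, h2⟩ := Nat.find_spec hex
  refine ⟨Nat.find hex, h1, ?_, h2, ?_⟩
  · have := Nat.find_min' hex
      ⟨show N ≤ M - 1 by omega, by rw [Nat.sub_add_cancel (by omega)]; exact hz.1⟩
    omega
  · rcases h1.eq_or_lt with h | h
    · rw [← h]
      exact hz.2
    · have := Nat.find_min hex (show Nat.find hex - 1 < Nat.find hex by omega)
      rw [Nat.sub_add_cancel (by omega)] at this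
      by_contra hlt
      exact this ⟨by omega, not_le.mp hlt⟩

lemma exists_half {n : ℕ} (hn : 1 ≤ n) (ha : ∀ m, n ≤ m → P.a m ≤ 1 / 4 * P.t m) :
    ∃ m, n < m ∧ P.t m ≤ P.t n / 2 ∧ P.t n / 4 ≤ P.t m := by
  classical
  have htn := P.t_pos hn
  have hex : ∃ m, n ≤ m ∧ P.t (m + 1) ≤ P.t n / 2 := by
    obtain ⟨m, hm, hm'⟩ := ((P.tendsto_t.comp (tendsto_add_atTop_nat 1)).eventually
      (gt_mem_nhds (half_pos htn)) |>.and (eventually_ge_atTop n)).exists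
    exact ⟨m, hm', hm.le⟩
  obtain ⟨h1, h2⟩ := Nat.find_spec hex
  refine ⟨Nat.find hex + 1, by omega, h2, ?_⟩
  have h3 : P.t n / 2 ≤ P.t (Nat.find hex) := by
    rcases h1.eq_or_lt with h | h
    · rw [← h]
      linarith
    · have := Nat.find_min hex (show Nat.find hex - 1 < Nat.find hex by omega)
      rw [Nat.sub_add_cancel (by omega)] at this
      by_contra hlt
      exact this ⟨by omega, (not_le.mp hlt).le⟩
  linarith [P.t_eq_add (hn.trans h1), ha _ h1]

/-- Cut points of consecutive blocks of digits along which the tails decay geometrically. -/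
lemma exists_blocks {N : ℕ} (hN : 1 ≤ N) (ha : ∀ m, N ≤ m → P.a m ≤ 1 / 4 * P.t m) :
    ∃ b : ℕ → ℕ, (∀ k, N ≤ b k) ∧ StrictMono b ∧
      (∀ k, P.t (b (k + 1)) ≤ P.t (b k) / 2) ∧ ∀ k, P.t N / 4 ^ k ≤ P.t (b k) := by
  have hex : ∀ n, ∃ m, N ≤ n → n < m ∧ P.t m ≤ P.t n / 2 ∧ P.t n / 4 ≤ P.t m := fun n => by
    by_cases h : N ≤ n
    · obtain ⟨m, hm⟩ := P.exists_half (hN.trans h) fun m hm => ha m (h.trans hm)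
      exact ⟨m, fun _ => hm⟩
    · exact ⟨0, fun h' => absurd h' h⟩
  choose f hf using hex
  have hb : ∀ k, N ≤ f^[k] N := fun k => by
    induction k with
    | zero => rfl
    | succ k ih =>
      rw [Function.iterate_succ_apply']
      exact ih.trans (hf _ ih).1.le
  refine ⟨fun k => f^[k] N, hb, strictMono_nat_of_lt_succ fun k => ?_, fun k => ?_, fun k => ?_⟩
  · rw [Function.iterate_succ_apply']
    exact (hf _ (hb k)).1
  · simp only [Function.iterate_succ_apply']
    exact (hf _ (hb k)).2.1
  · induction k with
    | zero => simp
    | succ k ih =>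
      simp only [Function.iterate_succ_apply', pow_succ, ← div_div] at ih ⊢
      linarith [(hf _ (hb k)).2.2]

/-- Expansion of a point of `[0,1)` whose `k`-th digit lies in the `k`-th block. -/
lemma exists_expansion {b : ℕ → ℕ} (hb1 : ∀ k, 1 ≤ b k) (hb : StrictMono b) {y : ℝ}
    (hy : y ∈ Ico (0 : ℝ) 1) :
    ∃ (n : ℕ → ℕ) (Y : ℕ → ℝ), Y 0 = y ∧ (∀ k, Y k ∈ Ico (0 : ℝ) 1) ∧
      (∀ k, b k ≤ n k ∧ n k < b (k + 1)) ∧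
      ∀ k, (P.t (b k) - P.t (b (k + 1))) * Y k =
        P.t (b k) - P.t (n k) + P.a (n k) * Y (k + 1) := by
  have step : ∀ (k : ℕ) (y : ℝ), ∃ (n : ℕ) (y' : ℝ), y ∈ Ico (0 : ℝ) 1 →
      (b k ≤ n ∧ n < b (k + 1)) ∧ y' ∈ Ico (0 : ℝ) 1 ∧
      (P.t (b k) - P.t (b (k + 1))) * y = P.t (b k) - P.t n + P.a n * y' := fun k y => by
    by_cases hy : y ∈ Ico (0 : ℝ) 1
    · have hlt := P.t_lt (hb1 k) (hb k.lt_succ_self)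
      obtain ⟨n, h1, h2, h3⟩ := P.exists_index (hb k.lt_succ_self)
        (z := P.t (b k) - (P.t (b k) - P.t (b (k + 1))) * y)
        ⟨by nlinarith [hy.2], by nlinarith [hy.1]⟩
      have hn := (hb1 k).trans h1
      have hpos := P.pos n hn
      have hadd := P.t_eq_add hn
      refine ⟨n, (P.t n - (P.t (b k) - (P.t (b k) - P.t (b (k + 1))) * y)) / P.a n,
        fun _ => ⟨⟨h1, h2⟩, ⟨?_, ?_⟩, ?_⟩⟩
      · exact div_nonneg (by linarith [h3.2]) hpos.le
      · rw [div_lt_one hpos]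
        linarith [h3.1]
      · field_simp
        ring
    · exact ⟨0, 0, fun h => absurd h hy⟩
  choose ν τ hstep using step
  let Y : ℕ → ℝ := fun k => Nat.rec y (fun k y => τ k y) k
  have hY : ∀ k, Y k ∈ Ico (0 : ℝ) 1 := fun k => by
    induction k with
    | zero => exact hy
    | succ k ih => exact (hstep k _ ih).2.1
  exact ⟨fun k => ν k (Y k), Y, rfl, hY, fun k => (hstep k _ (hY k)).1,
    fun k => (hstep k _ (hY k)).2.2⟩

/-- `n` codes the orbit `Y` of a point of `[0,1)` under the blockwise rescaled expansion with cut
points `b`, and the orbit `x` of the point with α-Lüroth digits `n`. -/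
structure IsCoding (b n : ℕ → ℕ) (Y x : ℕ → ℝ) : Prop where
  block_le : ∀ k, b k ≤ n k
  lt_block : ∀ k, n k < b (k + 1)
  mem_Ico : ∀ k, Y k ∈ Ico (0 : ℝ) 1
  pos : ∀ k, 0 < x k
  le_half : ∀ k, x k ≤ 1 / 2
  rescaled_rec : ∀ k, (P.t (b k) - P.t (b (k + 1))) * Y k =
    P.t (b k) - P.t (n k) + P.a (n k) * Y (k + 1)
  branch_rec : ∀ k, x k = P.t (n k) - P.a (n k) * x (k + 1)

variable {P}

lemma IsCoding.abs_sub_le_of_lt {b n m : ℕ → ℕ} {Y Z x u : ℕ → ℝ}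
    (h : P.IsCoding b n Y x) (h' : P.IsCoding b m Z u) {k : ℕ} (hn : 1 ≤ b k)
    (hnm : n k < m k) (ha : P.a (m k) ≤ P.a (n k)) :
    (P.t (b k) - P.t (b (k + 1))) * |Y k - Z k| ≤ 4 * |x k - u k| := by
  have hn1 := hn.trans (h.block_le k)
  have h0 := P.t_le hn (((h.block_le k).trans_lt (h.lt_block k)).le)
  have h1 := P.a_le_t_sub hn1 hnm
  have h2 := P.pos _ hn1
  have h3 := P.pos (m k) (by omega)
  have h4 : P.a (n k) * Y (k + 1) ≤ P.a (n k) := by nlinarith [(h.mem_Ico (k + 1)).2]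
  have h5 : P.a (m k) * Z (k + 1) ≤ P.a (m k) := by nlinarith [(h'.mem_Ico (k + 1)).2]
  have h6 := mul_nonneg h2.le (h.mem_Ico (k + 1)).1
  have h7 := mul_nonneg h3.le (h'.mem_Ico (k + 1)).1
  have h8 : P.a (n k) * x (k + 1) ≤ P.a (n k) / 2 := by nlinarith [h.le_half (k + 1)]
  have h9 := mul_pos h3 (h'.pos (k + 1))
  have h10 := h.rescaled_rec k
  have h11 := h'.rescaled_rec k
  have h12 := h.branch_rec k
  have h13 := h'.branch_rec k
  rw [← abs_of_nonneg (sub_nonneg.mpr h0), ← abs_mul, mul_sub, abs_of_nonpos (by linarith)]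
  linarith [le_abs_self (x k - u k)]

lemma IsCoding.abs_sub_le_of_ne {b n m : ℕ → ℕ} {Y Z x u : ℕ → ℝ}
    (h : P.IsCoding b n Y x) (h' : P.IsCoding b m Z u) {k : ℕ} (hn : 1 ≤ b k)
    (hnm : n k ≠ m k) (ha : ∀ i j, b k ≤ i → i ≤ j → P.a j ≤ P.a i) :
    (P.t (b k) - P.t (b (k + 1))) * |Y k - Z k| ≤ 4 * |x k - u k| := by
  rcases hnm.lt_or_gt with hlt | hlt
  · exact h.abs_sub_le_of_lt h' hn hlt (ha _ _ (h.block_le k) hlt.le)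
  · rw [abs_sub_comm (Y k), abs_sub_comm (x k)]
    exact h'.abs_sub_le_of_lt h hn hlt (ha _ _ (h'.block_le k) hlt.le)

lemma IsCoding.abs_sub_of_eq {b n m : ℕ → ℕ} {Y Z x u : ℕ → ℝ}
    (h : P.IsCoding b n Y x) (h' : P.IsCoding b m Z u) {k : ℕ} (hn : 1 ≤ b k)
    (hnm : n k = m k) :
    (P.t (b k) - P.t (b (k + 1))) * |Y k - Z k| = P.a (n k) * |Y (k + 1) - Z (k + 1)| ∧
      |x k - u k| = P.a (n k) * |x (k + 1) - u (k + 1)| := by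
  have h0 := P.t_le hn (((h.block_le k).trans_lt (h.lt_block k)).le)
  have h1 := P.pos _ (hn.trans (h.block_le k))
  have h10 := h.rescaled_rec k
  have h11 := h'.rescaled_rec k
  have h12 := h.branch_rec k
  have h13 := h'.branch_rec k
  rw [← hnm] at h11 h13
  constructor
  · rw [← abs_of_nonneg (sub_nonneg.mpr h0), ← abs_of_pos h1, ← abs_mul, ← abs_mul]
    congr 1
    linarith
  · rw [← abs_of_pos h1, ← abs_mul, ← abs_neg]
    congr 1
    linarith

/-- The coding map has a Hölder continuous inverse. -/
lemma IsCoding.abs_sub_le_rpow {b n m : ℕ → ℕ} {Y Z x u : ℕ → ℝ}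
    (h : P.IsCoding b n Y x) (h' : P.IsCoding b m Z u) {N : ℕ} (hN : 1 ≤ N)
    (hbN : ∀ k, N ≤ b k) (hhalf : ∀ k, P.t (b (k + 1)) ≤ P.t (b k) / 2)
    (hquarter : ∀ k, P.t N / 4 ^ k ≤ P.t (b k))
    (hdec : ∀ i j, N ≤ i → i ≤ j → P.a j ≤ P.a i)
    (ha : ∀ i, N ≤ i → P.a i ≤ 1 / 4 * P.t i) {s : ℝ} (hs : 0 < s) (hs1 : s < 1)
    (has : ∀ i, N ≤ i → P.a i ^ (1 - s) ≤ (4 : ℝ) ^ (-s) / 2 * P.t i) :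
    |Y 0 - Z 0| ≤ (8 / P.t N) ^ s * |x 0 - u 0| ^ s := by
  have hb1 : ∀ k, 1 ≤ b k := fun k => hN.trans (hbN k)
  have htN := P.t_pos hN
  have hone : ∀ k, |Y k - Z k| ≤ 1 := fun k => by
    have h1 := h.mem_Ico k
    have h2 := h'.mem_Ico k
    rw [abs_le]
    constructor <;> linarith [h1.1, h1.2, h2.1, h2.2]
  have hD : ∀ k, P.t (b k) / 2 ≤ P.t (b k) - P.t (b (k + 1)) := fun k => by linarith [hhalf k]
  by_cases hne : ∃ k, n k ≠ m k
  · have key : ∀ j k, (∀ i < j, n (k + i) = m (k + i)) → n (k + j) ≠ m (k + j) →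
        |Y k - Z k| ≤ (8 / P.t N * 4 ^ k) ^ s * |x k - u k| ^ s := by
      intro j
      induction j with
      | zero =>
        intro k _ hk
        have h1 := h.abs_sub_le_of_ne h' (hb1 k) hk fun i j hi hij => hdec i j ((hbN k).trans hi) hij
        have h2 : |Y k - Z k| ≤ 8 / P.t N * 4 ^ k * |x k - u k| := by
          have h3 := hquarter k
          rw [div_le_iff₀ (by positivity)] at h3
          have h4 : P.t (b k) * |Y k - Z k| ≤ 8 * |x k - u k| := by
            nlinarith [hD k, abs_nonneg (Y k - Z k)]
          rw [div_mul_eq_mul_div, div_mul_eq_mul_div, le_div_iff₀ htN]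
          calc |Y k - Z k| * P.t N ≤ |Y k - Z k| * (P.t (b k) * 4 ^ k) := by gcongr
            _ = P.t (b k) * |Y k - Z k| * 4 ^ k := by ring
            _ ≤ 8 * |x k - u k| * 4 ^ k := by gcongr
            _ = 8 * 4 ^ k * |x k - u k| := by ring
        calc |Y k - Z k| ≤ |Y k - Z k| ^ s :=
              Real.self_le_rpow_of_le_one (abs_nonneg _) (hone k) hs1.le
          _ ≤ (8 / P.t N * 4 ^ k * |x k - u k|) ^ s := by gcongr
          _ = _ := Real.mul_rpow (by positivity) (abs_nonneg _)
      | succ j ih =>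
        intro k heq hk
        have hidx : ∀ i, k + 1 + i = k + (i + 1) := fun i => by omega
        have h1 := ih (k + 1) (fun i hi => by rw [hidx]; exact heq _ (by omega))
          (by rw [hidx]; exact hk)
        obtain ⟨h2, h3⟩ := h.abs_sub_of_eq h' (hb1 k) (heq 0 (by omega))
        have hapos := P.pos _ ((hb1 k).trans (h.block_le k))
        have htb := P.t_pos (hb1 k)
        have h4 : P.a (n k) ^ (1 - s) * 4 ^ s ≤ P.t (b k) / 2 := by
          have h5 : P.a (n k) ^ (1 - s) ≤ (4 : ℝ) ^ (-s) / 2 * P.t (b k) :=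
            (Real.rpow_le_rpow hapos.le (hdec _ _ (hbN k) (h.block_le k)) (by linarith)).trans
              (has _ (hbN k))
          calc P.a (n k) ^ (1 - s) * 4 ^ s ≤ (4 : ℝ) ^ (-s) / 2 * P.t (b k) * 4 ^ s := by gcongr
            _ = ((4 : ℝ) ^ (-s) * 4 ^ s) * (P.t (b k) / 2) := by ring
            _ = P.t (b k) / 2 := by
              rw [← Real.rpow_add four_pos]
              simp
        have h6 : (8 / P.t N * 4 ^ (k + 1)) ^ s = (8 / P.t N * 4 ^ k) ^ s * (4 : ℝ) ^ s := by
          rw [← Real.mul_rpow (by positivity) (by positivity)]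
          ring_nf
        have h7 : P.a (n k) = P.a (n k) ^ (1 - s) * P.a (n k) ^ s := by
          rw [← Real.rpow_add hapos]
          simp
        have h8 : |x k - u k| ^ s = P.a (n k) ^ s * |x (k + 1) - u (k + 1)| ^ s := by
          rw [h3, Real.mul_rpow hapos.le (abs_nonneg _)]
        have hDk := hD k
        refine le_of_mul_le_mul_left ?_ (show 0 < P.t (b k) - P.t (b (k + 1)) by linarith)
        calc (P.t (b k) - P.t (b (k + 1))) * |Y k - Z k|
            = P.a (n k) * |Y (k + 1) - Z (k + 1)| := h2
          _ ≤ P.a (n k) * ((8 / P.t N * 4 ^ (k + 1)) ^ s * |x (k + 1) - u (k + 1)| ^ s) := by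
            gcongr
          _ = P.a (n k) ^ (1 - s) * 4 ^ s * ((8 / P.t N * 4 ^ k) ^ s * |x k - u k| ^ s) := by
            rw [h6, h8]
            nth_rewrite 1 [h7]
            ring
          _ ≤ (P.t (b k) - P.t (b (k + 1))) * ((8 / P.t N * 4 ^ k) ^ s * |x k - u k| ^ s) := by
            gcongr
            exact h4.trans hDk
    classical
    have := key (Nat.find hne) 0
      (fun i hi => by simpa using Nat.find_min hne hi) (by simpa using Nat.find_spec hne)
    simpa using this
  · push Not at hne
    have key : ∀ j k, |Y k - Z k| ≤ (1 / 2) ^ j := by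
      intro j
      induction j with
      | zero => simpa using hone
      | succ j ih =>
        intro k
        have h2 := (h.abs_sub_of_eq h' (hb1 k) (hne k)).1
        have h3 := hdec _ _ (hbN k) (h.block_le k)
        have h4 := ha _ (hbN k)
        have h5 := ih (k + 1)
        have htb := P.t_pos (hb1 k)
        have h6 : P.t (b k) / 2 * |Y k - Z k| ≤ P.t (b k) / 4 * (1 / 2) ^ j := by
          calc P.t (b k) / 2 * |Y k - Z k| ≤ (P.t (b k) - P.t (b (k + 1))) * |Y k - Z k| := by
                gcongr
                exact hD k
            _ = P.a (n k) * |Y (k + 1) - Z (k + 1)| := h2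
            _ ≤ P.t (b k) / 4 * (1 / 2) ^ j := by
                gcongr
                linarith
        rw [pow_succ]
        nlinarith
    have h0 : |Y 0 - Z 0| ≤ 0 := ge_of_tendsto'
      (tendsto_pow_atTop_nhds_zero_of_lt_one (by norm_num : (0 : ℝ) ≤ 1 / 2) (by norm_num))
      fun j => key j 0
    exact h0.trans (by positivity)

lemma IsCoding.mem_Finf {b n : ℕ → ℕ} {Y x : ℕ → ℝ} (h : P.IsCoding b n Y x)
    (hb1 : ∀ k, 1 ≤ b k) (hb : StrictMono b) : x 0 ∈ P.Finf := by
  have hdig : ∀ k, P.dseq k (x 0) = n k := P.dseq_eq (fun k => (hb1 k).trans (h.block_le k))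
    (fun k => ⟨(h.pos k).le, (h.le_half k).trans_lt (by norm_num)⟩) h.branch_rec
  refine ⟨⟨⟨h.pos 0, (h.le_half 0).trans (by norm_num)⟩, ?_⟩, fun k => ?_⟩
  · simp only [hdig]
    exact tendsto_atTop_mono h.block_le hb.tendsto_atTop
  · rw [hdig, hdig]
    exact (h.lt_block k).le.trans (h.block_le (k + 1))

lemma exists_isCoding {b : ℕ → ℕ} (hb1 : ∀ k, 1 ≤ b k) (hb : StrictMono b)
    (ht : ∀ n, b 0 ≤ n → P.t n ≤ 1 / 4) {y : ℝ} (hy : y ∈ Ico (0 : ℝ) 1) :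
    ∃ n Y x, P.IsCoding b n Y x ∧ Y 0 = y := by
  obtain ⟨n, Y, hY0, hY, hn, hrec⟩ := P.exists_expansion hb1 hb hy
  obtain ⟨x, hx, hxrec⟩ := P.exists_point (fun k => (hb1 k).trans (hn k).1)
    (fun k => ht _ ((hb.monotone (Nat.zero_le k)).trans (hn k).1))
  exact ⟨n, Y, x, ⟨fun k => (hn k).1, fun k => (hn k).2, hY, fun k => (hx k).1,
    fun k => (hx k).2, hrec, hxrec⟩, hY0⟩

lemma ofReal_le_dimH_Finf {θ s : ℝ} (hθ : 0 ≤ θ) (hexp : P.Expansive θ)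
    (hdec : P.EventuallyDecreasing) (hs : 0 < s) (hsθ : s < 1 / (1 + θ)) :
    ENNReal.ofReal s ≤ dimH P.Finf := by
  have hsθ' : s * (1 + θ) < 1 := by rwa [lt_div_iff₀ (by linarith)] at hsθ
  have hs1 : s < 1 := by nlinarith
  obtain ⟨η, hη, hsη⟩ : ∃ η, θ < η ∧ s * (1 + η) < 1 := by
    refine ⟨θ + (1 - s * (1 + θ)) / (2 * s), ?_, ?_⟩
    · have : 0 < (1 - s * (1 + θ)) / (2 * s) := div_pos (by linarith) (by linarith)
      linarith
    · field_simp
      linarith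
  obtain ⟨M, hM2, hd⟩ := P.exists_doubling hexp hη
  obtain ⟨N₀, hN₀⟩ := hdec
  have hd' : ∀ n, M + N₀ ≤ n → (2 : ℝ) ^ (-η) * P.t n ≤ P.t (2 * n) := fun n hn => hd n (by omega)
  obtain ⟨c, hc, hct⟩ := P.exists_le_t (hθ.trans hη.le) hM2 hd
  obtain ⟨K, hK, hKa⟩ := P.exists_a_le (by omega) hd' fun n hn => (hN₀ n (by omega)).le
  have hev1 := P.eventually_a_le_mul_t (by omega) hKa (show (0 : ℝ) < 1 / 4 by norm_num)
  have hev2 := P.eventually_rpow_a_le_mul_t (by omega) hc hK hKa (fun n hn => hct n (by omega))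
    hs hs1 hsη (show (0 : ℝ) < (4 : ℝ) ^ (-s) / 2 by positivity)
  have hev3 := P.tendsto_t.eventually (ge_mem_nhds (show (0 : ℝ) < 1 / 4 by norm_num))
  obtain ⟨N, hNall⟩ := eventually_atTop.mp
    (hev1.and (hev2.and (hev3.and (eventually_ge_atTop (N₀ + 1)))))
  have hN := (hNall N le_rfl).2.2.2
  have hN1 : 1 ≤ N := by omega
  have hanti : ∀ i j, N ≤ i → i ≤ j → P.a j ≤ P.a i := fun i j hi hij => by
    induction j, hij using Nat.le_induction with
    | base => rfl
    | succ j hj ih => exact (hN₀ j (by omega)).le.trans ih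
  obtain ⟨b, hbN, hb, hhalf, hquarter⟩ := P.exists_blocks hN1 fun m hm => (hNall m hm).1
  have hb1 : ∀ k, 1 ≤ b k := fun k => hN1.trans (hbN k)
  have hcode : ∀ y, ∃ n Y x, y ∈ Ico (0 : ℝ) 1 → P.IsCoding b n Y x ∧ Y 0 = y := fun y => by
    by_cases hy : y ∈ Ico (0 : ℝ) 1
    · obtain ⟨n, Y, x, h⟩ := P.exists_isCoding hb1 hb
        (fun n hn => (hNall n ((hbN 0).trans hn)).2.2.1) hy
      exact ⟨n, Y, x, fun _ => h⟩
    · exact ⟨0, 0, 0, fun h => absurd h hy⟩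
  choose n Y x hcode using hcode
  have htN := P.t_pos hN1
  refine le_dimH_of_abs_sub_le_rpow (g := fun y => x y 0) (C := (8 / P.t N) ^ s) hs
    (by positivity) (fun y hy => (hcode y hy).1.mem_Finf hb1 hb) fun y hy z hz => ?_
  have h := (hcode y hy).1.abs_sub_le_rpow (hcode z hz).1 hN1 hbN hhalf hquarter hanti
    (fun i hi => (hNall i hi).1) hs hs1 fun i hi => (hNall i hi).2.1
  rwa [(hcode y hy).2, (hcode z hz).2] at h

end LurothData

theorem dimension_Finf_lower_bound (P : LurothData) (θ : ℝ) (hθ : 0 ≤ θ)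
    (hexp : P.Expansive θ) (hdec : P.EventuallyDecreasing) :
    ENNReal.ofReal (1 / (1 + θ)) ≤ dimH P.Finf := by
  refine le_of_forall_lt fun c hc => ?_
  obtain ⟨r, hr1, hr2⟩ := ENNReal.lt_iff_exists_real_btwn.mp hc |>.imp fun r h => h.2
  have hr0 : 0 < r := ENNReal.ofReal_pos.mp (bot_le.trans_lt hr1)
  have hr : r < 1 / (1 + θ) := (ENNReal.ofReal_lt_ofReal_iff_of_nonneg hr0.le).mp hr2
  exact hr1.trans_le (LurothData.ofReal_le_dimH_Finf hθ hexp hdec hr0 hr)
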